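/- Let M be a finite unitary magma. The one-step rewrite relation ⇒ on binary trees with internal nodes labeled by M³ is confluent: whenever t ⇒* r_1 and t ⇒* r_2 (where ⇒* is the reflexive-transitive closure of ⇒), there exists a tree t' such that r_1 ⇒* t' and r_2 ⇒* t'. -/

import Mathlib

/-! Plane rooted binary trees with internal nodes labeled by `M`-triangles
(triples in `M³`), and the one-step rewrite relation `⇒` on them, for a unitary
magma `M` (modeled as `MulOneClass`). -/

/-- Binary trees with internal nodes labeled by `M³`. -/
inductive BT (M : Type) : Type
  | leaf : BT M
  | node : (M × M × M) → BT M → BT M → BT M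

namespace BT

variable {M : Type} [MulOneClass M]

/-- The one-step rewrite relation `⇒`: apply one of the rules (R1), (R2), (R3)
at any position inside a tree. -/
inductive Step : BT M → BT M → Prop
  | R1 (p q : M × M × M) (l1 l2 r : BT M) (h : q.1 ≠ 1) :
      Step (node p (node q l1 l2) r)
        (node (p.1, p.2.1 * q.1, p.2.2) (node (1, q.2.1, q.2.2) l1 l2) r)
  | R2 (p q : M × M × M) (l1 l2 r : BT M) (h : p.2.1 * q.1 = 1) :
      Step (node p (node q l1 l2) r)
        (node (p.1, q.2.1, 1) l1 (node (1, q.2.2, p.2.2) l2 r))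
  | R3 (p q : M × M × M) (l r1 r2 : BT M) (h : q.1 ≠ 1) :
      Step (node p l (node q r1 r2))
        (node (p.1, p.2.1, p.2.2 * q.1) l (node (1, q.2.1, q.2.2) r1 r2))
  | left (p : M × M × M) (l l' r : BT M) :
      Step l l' → Step (node p l r) (node p l' r)
  | right (p : M × M × M) (l r r' : BT M) :
      Step r r' → Step (node p l r) (node p l r')

end BT

namespace BT

open Relation

variable {M : Type} [MulOneClass M]

/-- The label of the base of the root triangle, with the convention `1` for a leaf. -/
def base : BT M → M
  | leaf => 1
  | node p _ _ => p.1

/-- Replace the base label of the root triangle by `1`. -/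
def strip : BT M → BT M
  | leaf => leaf
  | node p l r => node (1, p.2) l r

open Classical in
/-- Graft two trees in normal form on a triangle `p` and normalize the result: the base labels of
the subtrees are absorbed, and left edges with label `1` are rotated to the right. -/
noncomputable def graft : M × M × M → BT M → BT M → BT M
  | p, leaf, r => node (p.1, p.2.1, p.2.2 * base r) leaf (strip r)
  | p, node q l₁ l₂, r =>
    if p.2.1 * q.1 = 1 then node (p.1, q.2.1, 1) l₁ (graft (1, q.2.2, p.2.2) l₂ r)
    else node (p.1, p.2.1 * q.1, p.2.2 * base r) (node (1, q.2) l₁ l₂) (strip r)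

/-- The normal form of a tree. -/
noncomputable def normalForm : BT M → BT M
  | leaf => leaf
  | node p l r => graft p (normalForm l) (normalForm r)

@[simp] lemma base_strip (t : BT M) : base (strip t) = 1 := by
  cases t <;> rfl

@[simp] lemma strip_strip (t : BT M) : strip (strip t) = strip t := by
  cases t <;> rfl

@[simp] lemma base_graft (p : M × M × M) (l r : BT M) : base (graft p l r) = p.1 := by
  cases l with
  | leaf => rfl
  | node q l₁ l₂ => rw [graft]; split_ifs <;> rfl

@[simp] lemma strip_graft (p : M × M × M) (l r : BT M) :
    strip (graft p l r) = graft (1, p.2) l r := by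
  cases l with
  | leaf => rfl
  | node q l₁ l₂ => simp only [graft]; split_ifs <;> rfl

lemma graft_strip_left (a b c : M) (l r : BT M) :
    graft (a, b * base l, c) (strip l) r = graft (a, b, c) l r := by
  cases l with
  | leaf => simp [base, strip]
  | node q l₁ l₂ => simp only [graft, strip]; rw [mul_one]; rfl

lemma graft_strip_right (a b c : M) (l r : BT M) :
    graft (a, b, c * base r) l (strip r) = graft (a, b, c) l r := by
  induction l generalizing a b with
  | leaf => simp [graft]
  | node q l₁ l₂ _ ih => simp [graft, ih]

/-- Normalization identifies the two sides of the rotation rule. -/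
lemma graft_graft (p q : M × M × M) (s t u : BT M) (h : p.2.1 * q.1 = 1) :
    graft p (graft q s t) u = graft (p.1, q.2.1, 1) s (graft (1, q.2.2, p.2.2) t u) := by
  induction s generalizing p q with
  | leaf => simp [graft, h, graft_strip_left]
  | node a s₁ s₂ _ ih =>
    by_cases ha : q.2.1 * a.1 = 1
    · simp [graft, h, ha, ih]
    · simp [graft, h, ha, graft_strip_left]

lemma Step.normalForm_eq {t t' : BT M} (h : Step t t') : normalForm t = normalForm t' := by
  induction h with
  | R1 p q l₁ l₂ r h =>
    simpa [normalForm] using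
      (graft_strip_left p.1 p.2.1 p.2.2 (graft q (normalForm l₁) (normalForm l₂))
        (normalForm r)).symm
  | R2 p q l₁ l₂ r h => exact graft_graft p q _ _ _ h
  | R3 p q l r₁ r₂ h =>
    simpa [normalForm] using
      (graft_strip_right p.1 p.2.1 p.2.2 (normalForm l)
        (graft q (normalForm r₁) (normalForm r₂))).symm
  | left p l l' r _ ih => simp [normalForm, ih]
  | right p l r r' _ ih => simp [normalForm, ih]

lemma reflTransGen_node {l l' r r' : BT M} (p : M × M × M) (hl : ReflTransGen Step l l')
    (hr : ReflTransGen Step r r') : ReflTransGen Step (node p l r) (node p l' r') :=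
  (hl.lift (fun t => node p t r) fun _ _ => Step.left p _ _ r).trans
    (hr.lift (node p l') fun _ _ => Step.right p l' _ _)

lemma reflTransGen_strip_left (p : M × M × M) (l r : BT M) :
    ReflTransGen Step (node p l r) (node (p.1, p.2.1 * base l, p.2.2) (strip l) r) := by
  rcases l with _ | ⟨⟨a, q⟩, l₁, l₂⟩
  · simpa [base, strip] using ReflTransGen.refl
  · by_cases h : a = 1
    · subst h
      simpa [base, strip] using ReflTransGen.refl
    · exact .single (Step.R1 p (a, q) l₁ l₂ r h)

lemma reflTransGen_strip_right (p : M × M × M) (l r : BT M) :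
    ReflTransGen Step (node p l r) (node (p.1, p.2.1, p.2.2 * base r) l (strip r)) := by
  rcases r with _ | ⟨⟨a, q⟩, r₁, r₂⟩
  · simpa [base, strip] using ReflTransGen.refl
  · by_cases h : a = 1
    · subst h
      simpa [base, strip] using ReflTransGen.refl
    · exact .single (Step.R3 p (a, q) l r₁ r₂ h)

lemma reflTransGen_graft (p : M × M × M) (l r : BT M) :
    ReflTransGen Step (node p l r) (graft p l r) := by
  induction l generalizing p with
  | leaf => exact reflTransGen_strip_right p leaf r
  | node q l₁ l₂ _ ih =>
    rw [graft]
    split_ifs with h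
    · exact .head (Step.R2 p q l₁ l₂ r h) (reflTransGen_node _ .refl (ih _))
    · exact (reflTransGen_strip_left p (node q l₁ l₂) r).trans (reflTransGen_strip_right _ _ r)

lemma reflTransGen_normalForm (t : BT M) : ReflTransGen Step t (normalForm t) := by
  induction t with
  | leaf => exact .refl
  | node p l r ihl ihr => exact (reflTransGen_node p ihl ihr).trans (reflTransGen_graft p _ _)

lemma normalForm_eq_of_reflTransGen {t t' : BT M} (h : ReflTransGen Step t t') :
    normalForm t = normalForm t' := by
  induction h with
  | refl => rfl
  | tail _ hstep ih => exact ih.trans hstep.normalForm_eq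

end BT

/-- The rewrite relation `⇒` is confluent: if `t ⇒* r₁` and `t ⇒* r₂` then there is
a tree `t'` with `r₁ ⇒* t'` and `r₂ ⇒* t'`. -/
theorem statement10 (M : Type) [MulOneClass M] [Fintype M] (t r1 r2 : BT M)
    (h1 : Relation.ReflTransGen BT.Step t r1)
    (h2 : Relation.ReflTransGen BT.Step t r2) :
    ∃ t' : BT M, Relation.ReflTransGen BT.Step r1 t' ∧
      Relation.ReflTransGen BT.Step r2 t' := by
  refine ⟨BT.normalForm t, ?_, ?_⟩
  · rw [BT.normalForm_eq_of_reflTransGen h1]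
    exact BT.reflTransGen_normalForm r1
  · rw [BT.normalForm_eq_of_reflTransGen h2]
    exact BT.reflTransGen_normalForm r2
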